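/- Let O be an MV-topology on a set X and let M be a maximal element, with respect to set inclusion, of the collection 𝔉 of open coverings of X containing no additive covering. Then M is an ideal-like subset of O: (a) if α ∈ M, β ∈ O, and β ≤ α pointwise, then β ∈ M; and (b) if α, β ∈ M then α ⊕ β ∈ M. -/

import Mathlib

open Set

namespace MVTop

/-- Łukasiewicz truncated sum on the unit interval: `a ⊕ b = min (a + b) 1`. -/
noncomputable def mvAdd (a b : unitInterval) : unitInterval :=
  ⟨min (a.1 + b.1) 1, ⟨le_min (add_nonneg a.2.1 b.2.1) zero_le_one, min_le_right _ _⟩⟩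

/-- Łukasiewicz product on the unit interval: `a ⊙ b = max (a + b - 1) 0`. -/
noncomputable def mvMul (a b : unitInterval) : unitInterval :=
  ⟨max (a.1 + b.1 - 1) 0,
    ⟨le_max_right _ _, max_le (by nlinarith [a.2.1, a.2.2, b.2.1, b.2.2]) zero_le_one⟩⟩

variable {X Y : Type*}

/-- Pointwise truncated sum of fuzzy subsets. -/
noncomputable def fAdd (α β : X → unitInterval) : X → unitInterval := fun x => mvAdd (α x) (β x)

/-- Pointwise Łukasiewicz product of fuzzy subsets. -/
noncomputable def fMul (α β : X → unitInterval) : X → unitInterval := fun x => mvMul (α x) (β x)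

/-- Pointwise minimum of fuzzy subsets. -/
noncomputable def fInf (α β : X → unitInterval) : X → unitInterval := fun x => min (α x) (β x)

/-- Pointwise complement `α* = 1 - α`. -/
noncomputable def fStar (α : X → unitInterval) : X → unitInterval :=
  fun x => unitInterval.symm (α x)

instance : Fact ((0:ℝ) ≤ 1) := ⟨zero_le_one⟩

/-- Pointwise supremum of a family of fuzzy subsets. -/
noncomputable def fSup (Γ : Set (X → unitInterval)) : X → unitInterval :=
  fun x => ⨆ α ∈ Γ, α x

/-- The constant fuzzy subset `𝟏`. -/
noncomputable def fOne : X → unitInterval := fun _ => 1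

/-- The constant fuzzy subset `𝟎`. -/
noncomputable def fZero : X → unitInterval := fun _ => 0

/-- `fNsmul n α` is the `n`-fold truncated sum `α ⊕ ⋯ ⊕ α` (with `fNsmul 0 α = 𝟎`). -/
noncomputable def fNsmul : ℕ → (X → unitInterval) → (X → unitInterval)
  | 0, _ => fZero
  | n + 1, α => fAdd α (fNsmul n α)

/-- Truncated sum `f 0 ⊕ ⋯ ⊕ f (k-1)` of a finite family (empty sum is `𝟎`). -/
noncomputable def fSumFin : (k : ℕ) → (Fin k → (X → unitInterval)) → (X → unitInterval)
  | 0, _ => fZero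
  | k + 1, f => fAdd (f 0) (fSumFin k fun i => f i.succ)

/-- Łukasiewicz product `f 0 ⊙ ⋯ ⊙ f (k-1)` of a finite family (empty product is `𝟏`). -/
noncomputable def fMulFin : (k : ℕ) → (Fin k → (X → unitInterval)) → (X → unitInterval)
  | 0, _ => fOne
  | k + 1, f => fMul (f 0) (fMulFin k fun i => f i.succ)

/-- Pointwise minimum `f 0 ∧ ⋯ ∧ f (k-1)` of a finite family (empty infimum is `𝟏`). -/
noncomputable def fInfFin : (k : ℕ) → (Fin k → (X → unitInterval)) → (X → unitInterval)
  | 0, _ => fOne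
  | k + 1, f => fInf (f 0) (fInfFin k fun i => f i.succ)

/-- `O ⊆ [0,1]^X` is an MV-topology on `X`. -/
structure IsMVTopology (O : Set (X → unitInterval)) : Prop where
  zero_mem : fZero ∈ O
  one_mem : fOne ∈ O
  sSup_mem : ∀ Γ ⊆ O, fSup Γ ∈ O
  add_mem : ∀ o₁ ∈ O, ∀ o₂ ∈ O, fAdd o₁ o₂ ∈ O
  mul_mem : ∀ o₁ ∈ O, ∀ o₂ ∈ O, fMul o₁ o₂ ∈ O
  inf_mem : ∀ o₁ ∈ O, ∀ o₂ ∈ O, fInf o₁ o₂ ∈ O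

/-- Continuity of a map between MV-topological spaces. -/
def MVContinuous (O_X : Set (X → unitInterval)) (O_Y : Set (Y → unitInterval))
    (f : X → Y) : Prop :=
  ∀ α ∈ O_Y, (fun x => α (f x)) ∈ O_X

/-- `Γ` contains an additive covering: finitely many of its elements `α i` and positive
integers `n i` with `n 0 • α 0 ⊕ ⋯ ⊕ n (k-1) • α (k-1) = 𝟏`. -/
def ContainsAdditiveCover (Γ : Set (X → unitInterval)) : Prop :=
  ∃ (k : ℕ) (α : Fin k → X → unitInterval) (n : Fin k → ℕ),
    (∀ i, α i ∈ Γ) ∧ (∀ i, 0 < n i) ∧ fSumFin k (fun i => fNsmul (n i) (α i)) = fOne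

/-- Compactness: every open covering contains an additive covering. -/
def MVCompact (O : Set (X → unitInterval)) : Prop :=
  ∀ Γ ⊆ O, fSup Γ = fOne → ContainsAdditiveCover Γ

/-- The Hausdorff separation property for MV-topologies. -/
def MVHausdorff (O : Set (X → unitInterval)) : Prop :=
  ∀ x y : X, x ≠ y → ∃ ox ∈ O, ∃ oy ∈ O,
    ox x = 1 ∧ oy y = 1 ∧ fInf ox oy = fZero

/-- Zero-dimensionality: every open set is a supremum of clopen fuzzy subsets. -/
def MVZeroDim (O : Set (X → unitInterval)) : Prop :=
  ∀ o ∈ O, ∃ Γ : Set (X → unitInterval),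
    (∀ u ∈ Γ, u ∈ O ∧ fStar u ∈ O) ∧ fSup Γ = o

/-- `GenBase S` is the smallest set containing `S` and closed under `⊕`, `⊙`, `∧`
(the base `B_S` generated by a subbase `S`). -/
inductive GenBase (S : Set (X → unitInterval)) : (X → unitInterval) → Prop
  | base : ∀ α ∈ S, GenBase S α
  | add : ∀ α β, GenBase S α → GenBase S β → GenBase S (fAdd α β)
  | mul : ∀ α β, GenBase S α → GenBase S β → GenBase S (fMul α β)
  | inf : ∀ α β, GenBase S α → GenBase S β → GenBase S (fInf α β)

/-- `S` is a subbase for the MV-topology `O`. -/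
def IsSubbase (O S : Set (X → unitInterval)) : Prop :=
  S ⊆ O ∧ ∀ α ∈ O, ∃ Γ : Set (X → unitInterval),
    (∀ β ∈ Γ, GenBase S β) ∧ fSup Γ = α

/-- `S` is a large subbase for `O`: a subbase closed under the maps `α ↦ nα`, `n ≥ 1`. -/
def IsLargeSubbase (O S : Set (X → unitInterval)) : Prop :=
  IsSubbase O S ∧ ∀ α ∈ S, ∀ n : ℕ, 0 < n → fNsmul n α ∈ S

/-- `Θ` is a base for the MV-topology `O`. -/
def IsBase (O Θ : Set (X → unitInterval)) : Prop :=
  Θ ⊆ O ∧ ∀ α ∈ O, ∃ Γ ⊆ Θ, fSup Γ = α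

/-- The collection `𝔉` of open coverings of `X` containing no additive covering. -/
def MVF (O : Set (X → unitInterval)) : Set (Set (X → unitInterval)) :=
  {Γ | Γ ⊆ O ∧ fSup Γ = fOne ∧ ¬ ContainsAdditiveCover Γ}

/-- `M` is a maximal element of `𝔉` with respect to set inclusion. -/
def IsMaximalIn (M O : Set (X → unitInterval)) : Prop :=
  M ∈ MVF O ∧ ∀ Γ ∈ MVF O, M ⊆ Γ → Γ = M

variable {I : Type*} {Xf : I → Type*}

/-- The canonical subbase `S = {α ∘ π i : α ∈ O i, i ∈ I}` of the product MV-topology. -/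
def ProdSubbase (O : ∀ i, Set (Xf i → unitInterval)) :
    Set ((∀ i, Xf i) → unitInterval) :=
  {β | ∃ i, ∃ α ∈ O i, β = fun x => α (x i)}

/-- The product MV-topology: the smallest MV-topology containing `ProdSubbase O`. -/
def ProductMVTopology (O : ∀ i, Set (Xf i → unitInterval)) :
    Set ((∀ i, Xf i) → unitInterval) :=
  ⋂₀ {T | IsMVTopology T ∧ ProdSubbase O ⊆ T}


/-- The additive monoid of real-valued functions generated by a family of fuzzy subsets. -/
def realSums {X : Type*} (Γ : Set (X → unitInterval)) : AddSubmonoid (X → ℝ) :=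
  AddSubmonoid.closure ((fun α x => (α x : ℝ)) '' Γ)

theorem coe_mem_realSums {X : Type*} {Γ : Set (X → unitInterval)} {α : X → unitInterval}
    (h : α ∈ Γ) : (fun x => (α x : ℝ)) ∈ realSums Γ :=
  AddSubmonoid.subset_closure ⟨α, h, rfl⟩

theorem coe_fAdd {X : Type*} (α β : X → unitInterval) (x : X) :
    (fAdd α β x : ℝ) = min ((α x : ℝ) + β x) 1 := rfl

theorem coe_fNsmul {X : Type*} (n : ℕ) (α : X → unitInterval) (x : X) :
    (fNsmul n α x : ℝ) = min (n * (α x : ℝ)) 1 := by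
  have h0 := (α x).2.1
  induction n with
  | zero => simp [fNsmul, fZero]
  | succ n ih =>
    rw [fNsmul, coe_fAdd, ih]
    push_cast
    grind

theorem coe_fSumFin {X : Type*} (k : ℕ) (f : Fin k → X → unitInterval) (x : X) :
    (fSumFin k f x : ℝ) = min (∑ i, (f i x : ℝ)) 1 := by
  induction k with
  | zero => simp [fSumFin, fZero]
  | succ k ih =>
    have h0 := (f 0 x).2.1
    rw [fSumFin, coe_fAdd, ih, Fin.sum_univ_succ]
    grind

theorem eq_fOne_iff {X : Type*} {α : X → unitInterval} :
    α = fOne ↔ ∀ x, 1 ≤ (α x : ℝ) := by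
  refine ⟨fun h x => by simp [h, fOne], fun h => funext fun x => ?_⟩
  exact Subtype.ext (le_antisymm (α x).2.2 (h x))

theorem containsAdditiveCover_iff {X : Type*} {Γ : Set (X → unitInterval)} :
    ContainsAdditiveCover Γ ↔ ∃ f ∈ realSums Γ, ∀ x, 1 ≤ f x := by
  constructor
  · rintro ⟨k, α, n, hα, -, h⟩
    refine ⟨∑ i, n i • fun x => (α i x : ℝ),
      sum_mem fun i _ => nsmul_mem (coe_mem_realSums (hα i)) _, fun x => ?_⟩
    have hx := eq_fOne_iff.1 h x
    rw [coe_fSumFin, le_min_iff] at hx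
    refine hx.1.trans ?_
    rw [Finset.sum_apply]
    refine Finset.sum_le_sum fun i _ => ?_
    rw [coe_fNsmul]
    simp
  · rintro ⟨f, hf, h⟩
    obtain ⟨l, hl, rfl⟩ := AddSubmonoid.exists_list_of_mem_closure hf
    choose α hα hαl using fun i : Fin l.length => hl l[i] (l.getElem_mem i.2)
    refine ⟨l.length, α, fun _ => 1, hα, fun _ => one_pos, eq_fOne_iff.2 fun x => ?_⟩
    have hα1 (i : Fin l.length) : (fNsmul 1 (α i) x : ℝ) = l[i] x := by
      rw [coe_fNsmul, ← hαl]
      simpa using (α i x).2.2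
    rw [coe_fSumFin, le_min_iff]
    refine ⟨?_, le_rfl⟩
    simp_rw [hα1]
    have hx := h x
    rw [← Fin.sum_univ_getElem, Finset.sum_apply] at hx
    exact hx

theorem exists_le_realSums_of_insert {X : Type*} {Γ : Set (X → unitInterval)}
    {γ : X → unitInterval} {g : X → ℝ} (hg : g ∈ realSums Γ) (hγ : ∀ x, (γ x : ℝ) ≤ g x)
    {f : X → ℝ} (hf : f ∈ realSums (insert γ Γ)) : ∃ f' ∈ realSums Γ, f ≤ f' := by
  induction hf using AddSubmonoid.closure_induction with
  | mem f hf =>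
    obtain ⟨α, rfl | hα, rfl⟩ := hf
    · exact ⟨g, hg, hγ⟩
    · exact ⟨_, coe_mem_realSums hα, le_rfl⟩
  | zero => exact ⟨0, zero_mem _, le_rfl⟩
  | add f₁ f₂ _ _ h₁ h₂ =>
    obtain ⟨g₁, hg₁, hle₁⟩ := h₁
    obtain ⟨g₂, hg₂, hle₂⟩ := h₂
    exact ⟨g₁ + g₂, add_mem hg₁ hg₂, add_le_add hle₁ hle₂⟩

/-- A maximal element of `𝔉` contains every open set dominated by a finite sum of its elements. -/
theorem IsMaximalIn.mem_of_le {X : Type*} {O M : Set (X → unitInterval)} (hM : IsMaximalIn M O)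
    {γ : X → unitInterval} (hγO : γ ∈ O) {g : X → ℝ} (hg : g ∈ realSums M)
    (hγ : ∀ x, (γ x : ℝ) ≤ g x) : γ ∈ M := by
  obtain ⟨⟨hMO, hsup, hcov⟩, hmax⟩ := hM
  rw [← hmax (insert γ M) ⟨insert_subset hγO hMO, ?_, ?_⟩ (subset_insert γ M)]
  · exact mem_insert γ M
  · refine eq_fOne_iff.2 fun x => (eq_fOne_iff.1 hsup x).trans ?_
    exact biSup_mono (f := fun α : X → unitInterval => α x) fun _ => mem_insert_of_mem γ
  · intro h
    obtain ⟨f, hf, hf1⟩ := containsAdditiveCover_iff.1 h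
    obtain ⟨f', hf', hle⟩ := exists_le_realSums_of_insert hg hγ hf
    exact hcov (containsAdditiveCover_iff.2 ⟨f', hf', fun x => (hf1 x).trans (hle x)⟩)

/-- a maximal element `M` of `𝔉` is an ideal-like subset of `O`:
downward closed (within `O`) and closed under the truncated sum. -/
theorem maximal_is_ideal {X : Type*} (O : Set (X → unitInterval))
    (hO : IsMVTopology O) (M : Set (X → unitInterval)) (hM : IsMaximalIn M O) :
    (∀ α ∈ M, ∀ β ∈ O, (∀ x, β x ≤ α x) → β ∈ M) ∧
    (∀ α ∈ M, ∀ β ∈ M, fAdd α β ∈ M) := by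
  refine ⟨fun α hα β hβ hle => hM.mem_of_le hβ (coe_mem_realSums hα) hle, fun α hα β hβ => ?_⟩
  exact hM.mem_of_le (hO.add_mem α (hM.1.1 hα) β (hM.1.1 hβ))
    (add_mem (coe_mem_realSums hα) (coe_mem_realSums hβ)) fun x => min_le_left _ _

end MVTop
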